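/- arXiv:2604.13619 — 2 statements merged into one kernel-verified Lean document; each statement's English description precedes it below -/
import Mathlib

section
/- Let A be a ring and B a commutative ring. Let f, g : A → B be two central ℤ-linear maps, let p ∈ ℕ, and let a_1, …, a_p ∈ A. Then (f+g)_p(a_1, a_2, …, a_p) = Σ_{U ⊔ V = [p]} f_U(a) · g_V(a), where the sum ranges over all pairs (U, V) of disjoint subsets of [p] = {1, …, p} with U ∪ V = [p] (i.e., V is the complement of U in [p]). -/
open scoped Classical

noncomputable section

/-- A `ℤ`-linear map `f : A → B` is *central* if `f (a * a') = f (a' * a)` for all `a, a'`. -/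
def Central {A B : Type*} [Ring A] [CommRing B] (f : A →ₗ[ℤ] B) : Prop :=
  ∀ a a' : A, f (a * a') = f (a' * a)

/-- The product `a x * a (σ x) * a (σ² x) * ⋯` along the cycle of the permutation `σ`
containing `x`, starting at `x` (the cycle has length `Function.minimalPeriod σ x`). -/
def cycleProdAt {ι A : Type*} [Ring A] (a : ι → A) (σ : Equiv.Perm ι) (x : ι) : A :=
  ((List.range (Function.minimalPeriod (⇑σ) x)).map (fun j => a ((σ ^ j) x))).prod

/-- The Frobenius map of a central `ℤ`-linear map `f : A → B`, applied to a finite family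
`a : ι → A`:  `∑_{σ} sgn σ • ∏_{cycles c of σ} f (a_{i₁} a_{i₂} ⋯ a_{i_k})`, where each cycle
is represented by the product along it starting from its distinguished element (the one
minimizing a fixed enumeration of `ι`); when `f` is central this agrees with the classical
definition, which is independent of the starting points. -/
def frob {ι A B : Type*} [Fintype ι] [DecidableEq ι] [Ring A] [CommRing B]
    (f : A →ₗ[ℤ] B) (a : ι → A) : B :=
  ∑ σ : Equiv.Perm ι, (Equiv.Perm.sign σ : ℤ) •
    ∏ x : ι,
      if ∀ j : ℕ, (Fintype.equivFin ι) x ≤ (Fintype.equivFin ι) ((σ ^ j) x)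
      then f (cycleProdAt a σ x) else 1

/-- `f` is an `n`-homomorphism if it is central and its `(n+1)`-Frobenius map vanishes. -/
def IsNHom {A B : Type*} [Ring A] [CommRing B] (n : ℕ) (f : A →ₗ[ℤ] B) : Prop :=
  Central f ∧ ∀ a : Fin (n + 1) → A, frob f a = 0

/-- `π` is a set partition of the finite set `J`: its blocks are nonempty, pairwise
disjoint, and their union is `J`. -/
def IsSetPartition {α : Type*} [DecidableEq α] (J : Finset α) (π : Finset (Finset α)) : Prop :=
  (∀ P ∈ π, P.Nonempty) ∧
  (∀ P ∈ π, ∀ Q ∈ π, P ≠ Q → Disjoint P Q) ∧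
  π.biUnion id = J

/-- Delete the element `n` from the block of `π` containing it (removing the block if it
becomes empty). -/
def delPart (n : ℕ) (π : Finset (Finset ℕ)) : Finset (Finset ℕ) :=
  (π.image (fun P => P.erase n)).erase ∅

def IsMinRep {ι : Type*} (e : ι → ℕ) (σ : Equiv.Perm ι) (x : ι) : Prop :=
  ∀ j : ℕ, e x ≤ e ((σ ^ j) x)

lemma cycleProdAt_apply {ι A B : Type*} [Fintype ι] [Ring A] [CommRing B]
    (f : A →ₗ[ℤ] B) (hf : Central f) (a : ι → A) (σ : Equiv.Perm ι) (x : ι) :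
    f (cycleProdAt a σ (σ x)) = f (cycleProdAt a σ x) := by
  have hper : x ∈ Function.periodicPts (⇑σ) := by
    refine Function.mem_periodicPts.2 ⟨orderOf σ, orderOf_pos σ, ?_⟩
    show (⇑σ)^[orderOf σ] x = x
    rw [← Equiv.Perm.coe_pow, pow_orderOf_eq_one]; rfl
  have hn := Function.minimalPeriod_pos_of_mem_periodicPts hper
  have h1 : Function.minimalPeriod (⇑σ) (σ x) = Function.minimalPeriod (⇑σ) x :=
    Function.minimalPeriod_apply hper
  have h2 : (σ ^ (Function.minimalPeriod (⇑σ) x)) x = x := by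
    rw [Equiv.Perm.coe_pow]; exact Function.isPeriodicPt_minimalPeriod _ _
  unfold cycleProdAt
  rw [h1]
  obtain ⟨m, hm⟩ := Nat.exists_eq_succ_of_ne_zero hn.ne'
  rw [hm] at h2 ⊢
  have key : ∀ j, (σ ^ j) (σ x) = (σ ^ (j+1)) x := fun j => by
    rw [pow_succ]; rfl
  conv_lhs => rw [List.range_succ]
  conv_rhs => rw [List.range_succ_eq_map]
  simp only [List.map_append, List.prod_append, List.map_cons, List.prod_cons, List.map_nil,
    List.prod_nil, mul_one, List.map_map, key, Function.comp_def, Nat.succ_eq_add_one, pow_zero,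
    Equiv.Perm.one_apply]
  rw [hf]
  rw [Nat.succ_eq_add_one] at h2
  rw [h2]

lemma cycleProdAt_sameCycle {ι A B : Type*} [Fintype ι] [Ring A] [CommRing B]
    (f : A →ₗ[ℤ] B) (hf : Central f) (a : ι → A) (σ : Equiv.Perm ι) {x y : ι}
    (h : σ.SameCycle x y) :
    f (cycleProdAt a σ x) = f (cycleProdAt a σ y) := by
  obtain ⟨n, rfl⟩ := h.exists_nat_pow_eq
  induction n with
  | zero => rfl
  | succ n ih =>
    rw [pow_succ', Equiv.Perm.mul_apply, cycleProdAt_apply f hf]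
    exact ih ⟨n, rfl⟩

lemma exists_rep {ι : Type*} [Fintype ι] (e : ι → ℕ) (σ : Equiv.Perm ι) (x : ι) :
    ∃ y, σ.SameCycle x y ∧ IsMinRep e σ y := by
  obtain ⟨y, hy, hmin⟩ := Finset.exists_min_image (Finset.univ.filter (fun y => σ.SameCycle x y)) e
    ⟨x, by simp [Equiv.Perm.SameCycle.refl]⟩
  simp only [Finset.mem_filter, Finset.mem_univ, true_and] at hy hmin
  exact ⟨y, hy, fun j => hmin _ (hy.trans ⟨j, rfl⟩)⟩

lemma rep_unique {ι : Type*} [Fintype ι] (e : ι → ℕ) (he : Function.Injective e)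
    (σ : Equiv.Perm ι) {x y : ι} (hx : IsMinRep e σ x) (hy : IsMinRep e σ y)
    (h : σ.SameCycle x y) : x = y := by
  obtain ⟨n, hn⟩ := h.exists_nat_pow_eq
  obtain ⟨m, hm⟩ := h.symm.exists_nat_pow_eq
  apply he
  apply le_antisymm
  · rw [← hn]; exact hx n
  · rw [← hm]; exact hy m

lemma prod_rep {ι B : Type*} [Fintype ι] [CommRing B] (e e' : ι → ℕ)
    (he : Function.Injective e) (he' : Function.Injective e')
    (σ : Equiv.Perm ι) (h : ι → B) (hh : ∀ x y, σ.SameCycle x y → h x = h y) :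
    (∏ x, if IsMinRep e σ x then h x else 1) = ∏ x, if IsMinRep e' σ x then h x else 1 := by
  rw [← Finset.prod_filter, ← Finset.prod_filter]
  choose r hr hr2 using exists_rep e σ
  choose r' hr' hr2' using exists_rep e' σ
  refine Finset.prod_bij' (fun x _ => r' x) (fun x _ => r x) ?_ ?_ ?_ ?_ ?_
  · intro x _; simpa using hr2' x
  · intro x _; simpa using hr2 x
  · intro x hx
    simp only [Finset.mem_filter, Finset.mem_univ, true_and] at hx
    exact (rep_unique e he σ hx (hr2 _) ((hr' x).trans (hr _))).symm
  · intro x hx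
    simp only [Finset.mem_filter, Finset.mem_univ, true_and] at hx
    exact (rep_unique e' he' σ hx (hr2' _) ((hr x).trans (hr' _))).symm
  · intro x _; exact hh _ _ (hr' x)

lemma frob_eq {ι A B : Type*} [Fintype ι] [DecidableEq ι] [Ring A] [CommRing B]
    (f : A →ₗ[ℤ] B) (hf : Central f) (a : ι → A) (e : ι → ℕ) (he : Function.Injective e) :
    frob f a = ∑ σ : Equiv.Perm ι, (Equiv.Perm.sign σ : ℤ) •
      ∏ x : ι, if IsMinRep e σ x then f (cycleProdAt a σ x) else 1 := by
  unfold frob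
  refine Finset.sum_congr rfl fun σ _ => ?_
  rw [← prod_rep (fun x => ((Fintype.equivFin ι) x : ℕ)) e
    (fun x y h => (Fintype.equivFin ι).injective (Fin.ext h)) he σ _
    (fun x y h => cycleProdAt_sameCycle f hf a σ h)]
  congr 1

lemma coe_pow_of {ι : Type*} {P : ι → Prop} (σ : Equiv.Perm ι) (τ : Equiv.Perm {x // P x})
    (h : ∀ x, (τ x).1 = σ x.1) (j : ℕ) (x : {x // P x}) : ((τ ^ j) x).1 = (σ ^ j) x.1 := by
  induction j with
  | zero => rfl
  | succ n ih => rw [pow_succ', pow_succ', Equiv.Perm.mul_apply, Equiv.Perm.mul_apply, h, ih]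

lemma cycleProdAt_sub {ι A : Type*} [Ring A] {P : ι → Prop} (a : ι → A)
    (σ : Equiv.Perm ι) (τ : Equiv.Perm {x // P x})
    (h : ∀ x, (τ x).1 = σ x.1) (x : {x // P x}) :
    cycleProdAt (fun x : {x // P x} => a x.1) τ x = cycleProdAt a σ x.1 := by
  have hp : Function.minimalPeriod (⇑τ) x = Function.minimalPeriod (⇑σ) x.1 := by
    rw [Function.minimalPeriod_eq_minimalPeriod_iff]
    intro n
    unfold Function.IsPeriodicPt Function.IsFixedPt
    rw [← Equiv.Perm.coe_pow, ← Equiv.Perm.coe_pow, Subtype.ext_iff, coe_pow_of σ τ h]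
  unfold cycleProdAt
  rw [hp]
  simp only [coe_pow_of σ τ h]

lemma prod_sub {ι A B : Type*} [Fintype ι] [Ring A] [CommRing B]
    (f : A →ₗ[ℤ] B) (a : ι → A) (e : ι → ℕ) (U : Finset ι)
    (σ : Equiv.Perm ι) (τ : Equiv.Perm {x // x ∈ U}) (h : ∀ x, (τ x).1 = σ x.1) :
    (∏ x : {x // x ∈ U}, if IsMinRep (fun x : {x // x ∈ U} => e x.1) τ x then
      f (cycleProdAt (fun x : {x // x ∈ U} => a x.1) τ x) else 1) =
    ∏ x ∈ U, if IsMinRep e σ x then f (cycleProdAt a σ x) else 1 := by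
  rw [← Finset.prod_coe_sort U]
  refine Finset.prod_congr rfl fun x _ => ?_
  rw [cycleProdAt_sub a σ τ h]
  refine if_congr ?_ rfl rfl
  unfold IsMinRep
  simp only [coe_pow_of σ τ h]

lemma expand {ι B : Type*} [Fintype ι] [DecidableEq ι] [CommRing B] (e : ι → ℕ)
    (he : Function.Injective e)
    (σ : Equiv.Perm ι) (F G : ι → B) :
    (∏ x, if IsMinRep e σ x then F x + G x else 1) =
    ∑ U ∈ (Finset.univ : Finset (Finset ι)).filter (fun U => ∀ x, σ x ∈ U ↔ x ∈ U),
      (∏ x ∈ U, if IsMinRep e σ x then F x else 1) *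
      ∏ x ∈ Uᶜ, if IsMinRep e σ x then G x else 1 := by
  rw [← Finset.prod_filter, Finset.prod_add]
  choose r hr hr2 using exists_rep e σ
  have hrr : ∀ x y, σ.SameCycle x y → r x = r y := fun x y h =>
    rep_unique e he σ (hr2 x) (hr2 y) ((hr x).symm.trans (h.trans (hr y)))
  have hrf : ∀ x, IsMinRep e σ x → r x = x := fun x h =>
    (rep_unique e he σ h (hr2 x) (hr x)).symm
  have hinv : ∀ U : Finset ι, (∀ x, σ x ∈ U ↔ x ∈ U) → ∀ x y, σ.SameCycle x y →
      (y ∈ U ↔ x ∈ U) := by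
    intro U hU x y h
    obtain ⟨n, rfl⟩ := h.exists_nat_pow_eq
    clear h
    induction n with
    | zero => rfl
    | succ n ih => rw [pow_succ', Equiv.Perm.mul_apply, hU, ih]
  symm
  refine Finset.sum_bij' (fun U _ => U.filter (fun x => IsMinRep e σ x))
    (fun T _ => Finset.univ.filter (fun x => r x ∈ T)) ?_ ?_ ?_ ?_ ?_
  · intro U _
    rw [Finset.mem_powerset]
    exact Finset.filter_subset_filter _ (Finset.subset_univ _)
  · intro T _
    simp only [Finset.mem_filter, Finset.mem_univ, true_and]
    intro x
    rw [hrr (σ x) x (Equiv.Perm.SameCycle.symm ⟨1, rfl⟩)]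
  · intro U hU
    simp only [Finset.mem_filter, Finset.mem_univ, true_and] at hU
    ext x
    simp only [Finset.mem_filter, Finset.mem_univ, true_and]
    rw [hinv U hU x (r x) (hr x)]
    exact ⟨fun h => h.1, fun h => ⟨h, hr2 x⟩⟩
  · intro T hT
    rw [Finset.mem_powerset] at hT
    ext x
    simp only [Finset.mem_filter, Finset.mem_univ, true_and]
    constructor
    · rintro ⟨h1, h2⟩
      rwa [hrf x h2] at h1
    · intro h
      have h2 := (Finset.mem_filter.1 (hT h)).2
      exact ⟨by rwa [hrf x h2], h2⟩
  · intro U _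
    rw [← Finset.prod_filter, ← Finset.prod_filter]
    congr 1
    refine Finset.prod_congr ?_ fun _ _ => rfl
    ext x
    simp only [Finset.mem_filter, Finset.mem_univ, true_and, Finset.mem_sdiff, Finset.mem_compl]
    tauto

lemma frob_add {ι A B : Type*} [Fintype ι] [DecidableEq ι] [Ring A] [CommRing B]
    (f g : A →ₗ[ℤ] B) (hf : Central f) (hg : Central g) (a : ι → A)
    (e : ι → ℕ) (he : Function.Injective e) :
    frob (f + g) a =
      ∑ U : Finset ι,
        frob f (fun x : {x // x ∈ U} => a x.1) *
          frob g (fun x : {x // x ∈ Uᶜ} => a x.1) := by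
  have hfg : Central (f + g) := fun x y => by
    simp only [LinearMap.add_apply]; rw [hf, hg]
  rw [frob_eq (f + g) hfg a e he]
  simp only [LinearMap.add_apply]
  simp only [expand e he, Finset.smul_sum]
  simp only [Finset.sum_filter]
  rw [Finset.sum_comm]
  refine Finset.sum_congr rfl fun U _ => ?_
  rw [frob_eq f hf _ (fun x : {x // x ∈ U} => e x.1) (he.comp Subtype.val_injective),
    frob_eq g hg _ (fun x : {x // x ∈ Uᶜ} => e x.1) (he.comp Subtype.val_injective),
    Finset.sum_mul_sum, ← Finset.sum_product', ← Finset.sum_filter]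
  have hc : ∀ σ : Equiv.Perm ι, (∀ x, σ x ∈ U ↔ x ∈ U) → ∀ x, σ x ∈ Uᶜ ↔ x ∈ Uᶜ := by
    intro σ h x
    rw [Finset.mem_compl, Finset.mem_compl, h]
  have hL : ∀ (τ : Equiv.Perm {x // x ∈ U}) (ρ : Equiv.Perm {x // x ∈ Uᶜ}) (x : ι) (hx : x ∈ U),
      (Equiv.Perm.ofSubtype τ * Equiv.Perm.ofSubtype ρ) x = (τ ⟨x, hx⟩).1 := by
    intro τ ρ x hx
    rw [Equiv.Perm.mul_apply, Equiv.Perm.ofSubtype_apply_of_not_mem ρ (by simpa using hx),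
      Equiv.Perm.ofSubtype_apply_of_mem τ hx]
  have hR : ∀ (τ : Equiv.Perm {x // x ∈ U}) (ρ : Equiv.Perm {x // x ∈ Uᶜ}) (x : ι) (hx : x ∈ Uᶜ),
      (Equiv.Perm.ofSubtype τ * Equiv.Perm.ofSubtype ρ) x = (ρ ⟨x, hx⟩).1 := by
    intro τ ρ x hx
    rw [Equiv.Perm.mul_apply, Equiv.Perm.ofSubtype_apply_of_mem ρ hx,
      Equiv.Perm.ofSubtype_apply_of_not_mem τ (Finset.mem_compl.1 (ρ ⟨x, hx⟩).2)]
  symm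
  refine Finset.sum_bij' (fun q _ => Equiv.Perm.ofSubtype q.1 * Equiv.Perm.ofSubtype q.2)
    (fun σ h => (σ.subtypePerm (Finset.mem_filter.1 h).2,
      σ.subtypePerm (hc σ (Finset.mem_filter.1 h).2))) ?_ ?_ ?_ ?_ ?_
  · rintro ⟨τ, ρ⟩ _
    simp only [Finset.mem_filter, Finset.mem_univ, true_and]
    intro x
    by_cases hx : x ∈ U
    · rw [hL τ ρ x hx]; simp [hx]
    · have hx' := Finset.mem_compl.2 hx
      rw [hR τ ρ x hx']
      exact ⟨fun h => absurd h (Finset.mem_compl.1 (ρ ⟨x, hx'⟩).2), fun h => absurd h hx⟩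
  · intro σ _; simp
  · rintro ⟨τ, ρ⟩ _
    refine Prod.ext ?_ ?_
    · ext x
      exact hL τ ρ x.1 x.2
    · ext x
      exact hR τ ρ x.1 x.2
  · intro σ h
    ext x
    by_cases hx : x ∈ U
    · rw [hL _ _ x hx]; rfl
    · rw [hR _ _ x (Finset.mem_compl.2 hx)]; rfl
  · rintro ⟨τ, ρ⟩ _
    simp only
    rw [prod_sub f a e U _ τ (fun x => (hL τ ρ x.1 x.2).symm),
      prod_sub g a e Uᶜ _ ρ (fun x => (hR τ ρ x.1 x.2).symm), smul_mul_smul_comm]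
    congr 1
    rw [Equiv.Perm.sign_mul, Equiv.Perm.sign_ofSubtype, Equiv.Perm.sign_ofSubtype]
    push_cast
    rfl

/-- `(f+g)_p (a) = ∑_{U ⊔ V = [p]} f_U(a) · g_V(a)`, the sum being over all subsets `U`
of `[p]` with complement `V = Uᶜ`. -/
theorem stmt4 {A B : Type*} [Ring A] [CommRing B] (f g : A →ₗ[ℤ] B)
    (hf : Central f) (hg : Central g) (p : ℕ) (a : Fin p → A) :
    frob (f + g) a =
      ∑ U : Finset (Fin p),
        frob f (fun x : {x // x ∈ U} => a x.1) *
          frob g (fun x : {x // x ∈ Uᶜ} => a x.1) := by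
  convert frob_add f g hf hg a (fun x => x.1) Fin.val_injective
end
end

section
/- Let A and B be two rings with B commutative, and let n, m ∈ ℕ. If f : A → B is an n-homomorphism and g : A → B is an m-homomorphism, then the sum f + g is an (n+m)-homomorphism. -/
open scoped Classical

noncomputable section

theorem cyc_pos {ι : Type*} [Finite ι] (σ : Equiv.Perm ι) (x : ι) :
    0 < Function.minimalPeriod (⇑σ) x := by
  apply Function.minimalPeriod_pos_of_mem_periodicPts
  exact Function.Injective.mem_periodicPts σ.injective x

theorem cyc_pow {ι : Type*} (σ : Equiv.Perm ι) (x : ι) :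
    (σ ^ (Function.minimalPeriod (⇑σ) x)) x = x := by
  rw [← Equiv.Perm.iterate_eq_pow]
  exact Function.iterate_minimalPeriod

theorem cyc_const {ι A B : Type*} [Finite ι] [Ring A] [CommRing B] (f : A →ₗ[ℤ] B)
    (hf : Central f) (a : ι → A) (σ : Equiv.Perm ι) (x : ι) :
    f (cycleProdAt a σ (σ x)) = f (cycleProdAt a σ x) := by
  unfold cycleProdAt
  have h1 : Function.minimalPeriod (⇑σ) (σ x) = Function.minimalPeriod (⇑σ) x :=
    Function.minimalPeriod_apply (Function.Injective.mem_periodicPts σ.injective x)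
  have hp := cyc_pos σ x
  have h2 := cyc_pow σ x
  rw [h1]
  obtain ⟨q, hq⟩ : ∃ q, Function.minimalPeriod (⇑σ) x = q + 1 := ⟨_, (Nat.succ_pred_eq_of_pos hp).symm⟩
  rw [hq] at h2 ⊢
  have h3 : ∀ j, (σ ^ j) (σ x) = (σ ^ (j+1)) x := fun j => by
    rw [pow_succ, Equiv.Perm.mul_apply]
  simp only [h3]
  conv_rhs => rw [List.range_succ_eq_map]
  rw [List.range_succ]
  simp only [List.map_append, List.prod_append, List.map_cons, List.prod_cons, List.map_nil,
    List.prod_nil, mul_one, List.map_map, h2, pow_zero, Equiv.Perm.one_apply]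
  rw [hf]
  rfl

theorem rep_indep {ι B : Type*} [Fintype ι] [CommRing B] (σ : Equiv.Perm ι) (w : ι → B)
    (hw : ∀ x, w (σ x) = w x) (e : ι → ℕ) (he : Function.Injective e) :
    (∏ x : ι, if ∀ j : ℕ, e x ≤ e ((σ ^ j) x) then w x else 1) =
      ∏ q : Quotient (Equiv.Perm.SameCycle.setoid σ), w q.out := by
  have hpow : ∀ (j : ℕ) x, w ((σ ^ j) x) = w x := by
    intro j
    induction j with
    | zero => simp
    | succ j ih => intro x; rw [pow_succ, Equiv.Perm.mul_apply, ih, hw]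
  rw [← Finset.prod_fiberwise Finset.univ
    (fun x => (Quotient.mk (Equiv.Perm.SameCycle.setoid σ) x))]
  refine Finset.prod_congr rfl fun q _ => ?_
  have hsc : ∀ x y, (Quotient.mk (Equiv.Perm.SameCycle.setoid σ) x) =
      (Quotient.mk (Equiv.Perm.SameCycle.setoid σ) y) → ∃ j : ℕ, (σ ^ j) x = y := by
    intro x y h
    have h' : Equiv.Perm.SameCycle σ x y := Quotient.exact h
    obtain ⟨i, _, hi⟩ := h'.exists_pow_eq'
    exact ⟨i, hi⟩
  have hsc2 : ∀ x (j : ℕ), (Quotient.mk (Equiv.Perm.SameCycle.setoid σ) ((σ ^ j) x)) =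
      (Quotient.mk (Equiv.Perm.SameCycle.setoid σ) x) := by
    intro x j
    apply Quotient.sound
    exact Equiv.Perm.SameCycle.symm ⟨j, by simp⟩
  obtain ⟨x0, hx0, hmin⟩ := Finset.exists_min_image
    (Finset.univ.filter fun x => (Quotient.mk (Equiv.Perm.SameCycle.setoid σ) x) = q) e
    ⟨q.out, by simp⟩
  have hx0' : (Quotient.mk (Equiv.Perm.SameCycle.setoid σ) x0) = q := by simpa using hx0
  rw [Finset.prod_eq_single x0]
  · rw [if_pos]
    · obtain ⟨j, hj⟩ := hsc x0 q.out (by simp [hx0'])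
      rw [← hj, hpow]
    · intro j
      exact hmin _ (by simp [hsc2, hx0'])
  · intro y hy hne
    have hy' : (Quotient.mk (Equiv.Perm.SameCycle.setoid σ) y) = q := by simpa using hy
    rw [if_neg]
    intro h
    obtain ⟨j, hj⟩ := hsc y x0 (by rw [hx0', hy'])
    have := h j
    rw [hj] at this
    exact hne (he (le_antisymm this (hmin y hy)))
  · intro h; exact absurd hx0 h

/-- `σ` is obtained from `τ` by inserting `0` somewhere. -/
def InsRel {A : Type*} [Ring A] {k : ℕ} (σ : Equiv.Perm (Fin (k+1))) (τ : Equiv.Perm (Fin k))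
    (a : Fin (k+1) → A) (a' : Fin k → A) : Prop :=
  ∀ y, (σ y.succ = (τ y).succ ∧ a' y = a y.succ) ∨
    (σ y.succ = 0 ∧ σ 0 = (τ y).succ ∧ a' y = a y.succ * a 0)

theorem walk {A : Type*} [Ring A] {k : ℕ} (σ : Equiv.Perm (Fin (k+1))) (τ : Equiv.Perm (Fin k))
    (a : Fin (k+1) → A) (a' : Fin k → A) (h : InsRel σ τ a a') (x : Fin k) (N : ℕ) :
    ∃ N', N ≤ N' ∧ (N = 0 → N' = 0) ∧ (σ ^ N') x.succ = ((τ ^ N) x).succ ∧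
      ((List.range N').map (fun j => a ((σ ^ j) x.succ))).prod =
        ((List.range N).map (fun j => a' ((τ ^ j) x))).prod ∧
      ∀ M, 0 < M → M < N' → (σ ^ M) x.succ = 0 ∨
        ∃ M', 0 < M' ∧ M' < N ∧ (σ ^ M) x.succ = ((τ ^ M') x).succ := by
  induction N with
  | zero => exact ⟨0, by simp⟩
  | succ N ih =>
    obtain ⟨N', hle, h0, hs, hp, hM⟩ := ih
    have key : ∀ M, 0 < M → M < N' + 1 → (σ ^ M) x.succ = 0 ∨
        ∃ M', 0 < M' ∧ M' < N + 1 ∧ (σ ^ M) x.succ = ((τ ^ M') x).succ := by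
      intro M hM0 hM1
      rcases Nat.lt_succ_iff_lt_or_eq.mp hM1 with h1 | h1
      · rcases hM M hM0 h1 with h2 | ⟨M', h3, h4, h5⟩
        · exact Or.inl h2
        · exact Or.inr ⟨M', h3, by omega, h5⟩
      · subst h1
        exact Or.inr ⟨N, by by_contra h6; have := h0 (by omega); omega, by omega, hs⟩
    rcases h ((τ ^ N) x) with ⟨h1, h2⟩ | ⟨h1, h2, h3⟩
    · refine ⟨N' + 1, by omega, by omega, ?_, ?_, key⟩
      · rw [pow_succ', Equiv.Perm.mul_apply, hs, h1, pow_succ', Equiv.Perm.mul_apply]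
      · rw [List.range_succ, List.range_succ]
        simp [hp, hs, h2]
    · have e1 : (σ ^ (N' + 1)) x.succ = 0 := by
        rw [pow_succ', Equiv.Perm.mul_apply, hs, h1]
      refine ⟨N' + 1 + 1, by omega, by omega, ?_, ?_, ?_⟩
      · rw [pow_succ', Equiv.Perm.mul_apply, e1, h2, pow_succ' τ, Equiv.Perm.mul_apply]
      · rw [List.range_succ, List.range_succ, List.range_succ]
        simp [hp, hs, h3, e1]
      · intro M hM0 hM1
        rcases Nat.lt_succ_iff_lt_or_eq.mp hM1 with h4 | h4
        · exact key M hM0 h4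
        · subst h4; exact Or.inl e1

theorem ins_cyc {A : Type*} [Ring A] {k : ℕ} (σ : Equiv.Perm (Fin (k+1))) (τ : Equiv.Perm (Fin k))
    (a : Fin (k+1) → A) (a' : Fin k → A) (h : InsRel σ τ a a') (x : Fin k) :
    cycleProdAt a σ x.succ = cycleProdAt a' τ x := by
  obtain ⟨N', hle, h0, hs, hp, hM⟩ := walk σ τ a a' h x (Function.minimalPeriod (⇑τ) x)
  have hpos := cyc_pos τ x
  rw [cyc_pow] at hs
  have : Function.minimalPeriod (⇑σ) x.succ = N' := by
    apply le_antisymm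
    · apply Function.IsPeriodicPt.minimalPeriod_le (by omega)
      unfold Function.IsPeriodicPt Function.IsFixedPt
      rw [Equiv.Perm.iterate_eq_pow, hs]
    · by_contra hlt
      rcases hM _ (cyc_pos σ x.succ) (by omega) with h1 | ⟨M', h1, h2, h3⟩
      · rw [cyc_pow] at h1
        exact Fin.succ_ne_zero _ h1
      · rw [cyc_pow] at h3
        have h4 := Fin.succ_injective _ h3
        have : Function.minimalPeriod (⇑τ) x ≤ M' := by
          apply Function.IsPeriodicPt.minimalPeriod_le h1
          unfold Function.IsPeriodicPt Function.IsFixedPt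
          rw [Equiv.Perm.iterate_eq_pow, ← h4]
        omega
  unfold cycleProdAt
  rw [this, hp]

/-- the summand -/
def wt {ι A B : Type*} [Fintype ι] [Ring A] [CommRing B]
    (f : A →ₗ[ℤ] B) (a : ι → A) (σ : Equiv.Perm ι) : B :=
  ∏ x : ι,
      if ∀ j : ℕ, (Fintype.equivFin ι) x ≤ (Fintype.equivFin ι) ((σ ^ j) x)
      then f (cycleProdAt a σ x) else 1

theorem wt_eq {ι A B : Type*} [Fintype ι] [Ring A] [CommRing B]
    (f : A →ₗ[ℤ] B) (hf : Central f) (a : ι → A) (σ : Equiv.Perm ι) (e : ι → ℕ)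
    (he : Function.Injective e) :
    wt f a σ = ∏ x : ι, if ∀ j : ℕ, e x ≤ e ((σ ^ j) x) then f (cycleProdAt a σ x) else 1 := by
  have hc := cyc_const f hf a σ
  rw [rep_indep σ (fun x => f (cycleProdAt a σ x)) hc e he]
  exact rep_indep σ (fun x => f (cycleProdAt a σ x)) hc (fun x => (Fintype.equivFin ι x : ℕ))
      (Fin.val_injective.comp (Fintype.equivFin ι).injective)

theorem wt_ins {A B : Type*} [Ring A] [CommRing B] {k : ℕ}
    (f : A →ₗ[ℤ] B) (hf : Central f) (σ : Equiv.Perm (Fin (k+1))) (τ : Equiv.Perm (Fin k))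
    (a : Fin (k+1) → A) (a' : Fin k → A) (h : InsRel σ τ a a') :
    wt f a σ = (if σ 0 = 0 then f (a 0) else 1) * wt f a' τ := by
  have he : Function.Injective (Fin.cons k (fun x : Fin k => (x : ℕ)) : Fin (k+1) → ℕ) := by
    rw [Fin.cons_injective_iff]
    refine ⟨?_, Fin.val_injective⟩
    rintro ⟨y, hy⟩
    have := y.2
    simp at hy
    omega
  rw [wt_eq f hf a σ _ he, wt_eq f hf a' τ (fun x : Fin k => (x : ℕ)) Fin.val_injective,
    Fin.prod_univ_succ]
  congr 1
  · by_cases h0 : σ 0 = 0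
    · have hfix : ∀ j : ℕ, (σ ^ j) 0 = 0 := fun j => by
        induction j with
        | zero => simp
        | succ j ih => rw [pow_succ, Equiv.Perm.mul_apply, h0, ih]
      have : Function.minimalPeriod (⇑σ) 0 = 1 :=
        Function.minimalPeriod_eq_one_iff_isFixedPt.mpr h0
      simp [hfix, h0, cycleProdAt, this]
    · rw [if_neg h0, if_neg]
      intro hj
      have := hj 1
      obtain ⟨y, hy⟩ := Fin.exists_succ_eq.mpr h0
      rw [pow_one, ← hy] at this
      simp at this
      have := y.2
      omega
  · refine Finset.prod_congr rfl fun x _ => ?_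
    rw [ins_cyc σ τ a a' h x]
    refine if_congr ?_ rfl rfl
    constructor
    · intro hj N
      obtain ⟨N', _, _, hs, _⟩ := walk σ τ a a' h x N
      have := hj N'
      rw [hs] at this
      simpa using this
    · intro hj M
      rcases Nat.eq_zero_or_pos M with h0 | h0
      · simp [h0]
      obtain ⟨N', hle, _, hs, _, hM⟩ := walk σ τ a a' h x (M+1)
      rcases hM M h0 (by omega) with h1 | ⟨M', _, _, h1⟩
      · rw [h1]
        simp
      · rw [h1]
        simpa using hj M'

/-- inserting zero -/
def insPerm {k : ℕ} : Fin (k+1) × Equiv.Perm (Fin k) ≃ Equiv.Perm (Fin (k+1)) :=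
  ((Equiv.refl _).prodCongr (Equiv.inv _)).trans
    (Equiv.Perm.decomposeFin.symm.trans (Equiv.inv _))

theorem insPerm_sign {k : ℕ} (p : Fin (k+1)) (τ : Equiv.Perm (Fin k)) :
    Equiv.Perm.sign (insPerm (p, τ)) = (if p = 0 then 1 else -1) * Equiv.Perm.sign τ := by
  simp [insPerm]

theorem insPerm_iff {k : ℕ} (p : Fin (k+1)) (τ : Equiv.Perm (Fin k)) (x y : Fin (k+1)) :
    insPerm (p, τ) x = y ↔ Equiv.Perm.decomposeFin.symm (p, τ⁻¹) y = x := by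
  simp only [insPerm, Equiv.trans_apply, Equiv.inv_apply, Equiv.prodCongr_apply, Prod.map,
    Equiv.refl_apply]
  rw [Equiv.Perm.inv_eq_iff_eq, eq_comm]

theorem ins_zero {A : Type*} [Ring A] {k : ℕ} (τ : Equiv.Perm (Fin k)) (a : Fin (k+1) → A) :
    InsRel (insPerm (0, τ)) τ a (fun y => a y.succ) := by
  intro y
  left
  simp [insPerm_iff]

theorem ins_succ {A : Type*} [Ring A] {k : ℕ} (i : Fin k) (τ : Equiv.Perm (Fin k))
    (a : Fin (k+1) → A) :
    InsRel (insPerm (i.succ, τ)) τ a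
      (Function.update (fun y => a y.succ) i (a i.succ * a 0)) := by
  intro y
  by_cases h : y = i
  · subst h
    right
    simp [insPerm_iff]
  · left
    refine ⟨?_, by simp [h]⟩
    rw [insPerm_iff]
    simp [Equiv.swap_apply_def, h]

theorem frob_succ {A B : Type*} [Ring A] [CommRing B] {k : ℕ}
    (f : A →ₗ[ℤ] B) (hf : Central f) (a : Fin (k+1) → A) :
    frob f a = f (a 0) * frob f (fun y : Fin k => a y.succ) -
      ∑ i : Fin k, frob f (Function.update (fun y => a y.succ) i (a i.succ * a 0)) := by
  have hfr : ∀ {n : ℕ} (b : Fin n → A), frob f b =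
      ∑ σ : Equiv.Perm (Fin n), (Equiv.Perm.sign σ : ℤ) • wt f b σ := fun b => rfl
  simp only [hfr]
  rw [← Equiv.sum_comp insPerm, Fintype.sum_prod_type, Fin.sum_univ_succ, sub_eq_add_neg,
    ← Finset.sum_neg_distrib, Finset.mul_sum]
  congr 1
  · refine Finset.sum_congr rfl fun τ _ => ?_
    rw [wt_ins f hf _ τ a _ (ins_zero τ a), insPerm_sign, if_pos ((insPerm_iff _ _ _ _).mpr (by simp))]
    simp
    ring
  · refine Finset.sum_congr rfl fun i _ => ?_
    rw [← Finset.sum_neg_distrib]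
    refine Finset.sum_congr rfl fun τ _ => ?_
    rw [wt_ins f hf _ τ a _ (ins_succ i τ a), insPerm_sign]
    have h0 : ¬ insPerm (i.succ, τ) 0 = 0 := by
      rw [insPerm_iff]; simp
    rw [if_neg h0]
    simp

/-- `frob` on lists -/
def FL {A B : Type*} [Ring A] [CommRing B] (f : A →ₗ[ℤ] B) (l : List A) : B :=
  frob f l.get

theorem FL_eq {A B : Type*} [Ring A] [CommRing B] (f : A →ₗ[ℤ] B) {n : ℕ} (a : Fin n → A)
    (l : List A) (h : n = l.length) (ha : ∀ i : Fin n, a i = l.get (Fin.cast h i)) :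
    frob f a = FL f l := by
  subst h
  have : a = l.get := funext ha
  rw [this, FL]

/-- sum over modifications of one entry -/
def MS {A B : Type*} [Ring A] [CommRing B] (a : A) : (List A → B) → List A → B
  | _, [] => 0
  | φ, b :: l => φ (b * a :: l) + MS a (fun l' => φ (b :: l')) l

/-- sum over splittings -/
def SS {A B : Type*} [Ring A] [CommRing B] : (List A → List A → B) → List A → B
  | H, [] => H [] []
  | H, b :: l => SS (fun s t => H (b :: s) t) l + SS (fun s t => H s (b :: t)) l

theorem MS_eq {A B : Type*} [Ring A] [CommRing B] (a : A) (φ : List A → B) (l : List A) :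
    MS a φ l = ∑ i : Fin l.length, φ (l.set i (l.get i * a)) := by
  induction l generalizing φ with
  | nil => simp [MS]
  | cons b l ih =>
    rw [MS, ih]
    exact (Fin.sum_univ_succ (fun i : Fin (l.length + 1) =>
      φ ((b :: l).set i ((b :: l).get i * a)))).symm

theorem FL_nil {A B : Type*} [Ring A] [CommRing B] (f : A →ₗ[ℤ] B) : FL f [] = 1 := by
  simp [FL, frob]

theorem FL_cons {A B : Type*} [Ring A] [CommRing B] (f : A →ₗ[ℤ] B) (hf : Central f)
    (a : A) (l : List A) : FL f (a :: l) = f a * FL f l - MS a (FL f) l := by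
  rw [MS_eq]
  have := frob_succ f hf (k := l.length) (a :: l).get
  refine this.trans ?_
  congr 1
  refine Finset.sum_congr rfl fun i _ => ?_
  apply FL_eq f _ _ (by simp)
  intro j
  simp only [List.get_eq_getElem, List.getElem_set, Function.update_apply, Fin.val_cast]
  by_cases h : j = i
  · simp [h]
  · have : (i : ℕ) ≠ j := fun h' => h (Fin.ext h'.symm)
    simp [h, this]

theorem MS_zero {A B : Type*} [Ring A] [CommRing B] (a : A) (φ : List A → B) (l : List A)
    (h : ∀ l', l'.length = l.length → φ l' = 0) : MS a φ l = 0 := by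
  rw [MS_eq]
  exact Finset.sum_eq_zero fun i _ => h _ (by simp)

theorem MS_add {A B : Type*} [Ring A] [CommRing B] (a : A) (φ ψ : List A → B) (l : List A) :
    MS a (fun l => φ l + ψ l) l = MS a φ l + MS a ψ l := by
  simp [MS_eq, Finset.sum_add_distrib]

theorem MS_mul_right {A B : Type*} [Ring A] [CommRing B] (a : A) (φ : List A → B) (c : B)
    (l : List A) : MS a (fun l => φ l * c) l = MS a φ l * c := by
  simp [MS_eq, Finset.sum_mul]

theorem MS_mul_left {A B : Type*} [Ring A] [CommRing B] (a : A) (φ : List A → B) (c : B)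
    (l : List A) : MS a (fun l => c * φ l) l = c * MS a φ l := by
  simp [MS_eq, Finset.mul_sum]

theorem MS_congr {A B : Type*} [Ring A] [CommRing B] (a : A) (φ ψ : List A → B) (l : List A)
    (h : ∀ l', l'.length = l.length → φ l' = ψ l') : MS a φ l = MS a ψ l := by
  rw [MS_eq, MS_eq]
  exact Finset.sum_congr rfl fun i _ => h _ (by simp)

theorem SS_add {A B : Type*} [Ring A] [CommRing B] (H K : List A → List A → B) (l : List A) :
    SS (fun s t => H s t + K s t) l = SS H l + SS K l := by
  induction l generalizing H K with
  | nil => simp [SS]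
  | cons b l ih => simp only [SS, ih]; ring

theorem SS_mul {A B : Type*} [Ring A] [CommRing B] (H : List A → List A → B) (c : B)
    (l : List A) : SS (fun s t => c * H s t) l = c * SS H l := by
  induction l generalizing H with
  | nil => simp [SS]
  | cons b l ih => simp only [SS, ih]; ring

theorem SS_zero {A B : Type*} [Ring A] [CommRing B] (H : List A → List A → B) (l : List A)
    (h : ∀ s t, s.length + t.length = l.length → H s t = 0) : SS H l = 0 := by
  induction l generalizing H with
  | nil => exact h _ _ rfl
  | cons b l ih =>
    rw [SS, ih, ih, add_zero]
    · intro s t hst; apply h; simp; omega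
    · intro s t hst; apply h; simp; omega

theorem MS_SS {A B : Type*} [Ring A] [CommRing B] (a : A) (H : List A → List A → B)
    (l : List A) :
    MS a (SS H) l = SS (fun s t => MS a (fun s' => H s' t) s + MS a (fun t' => H s t') t) l := by
  induction l generalizing H with
  | nil => simp [MS, SS]
  | cons b l ih =>
    simp only [MS, SS, MS_add, ih, SS_add]
    ring

theorem FL_add {A B : Type*} [Ring A] [CommRing B] (f g : A →ₗ[ℤ] B) (hf : Central f)
    (hg : Central g) (hfg : Central (f + g)) (k : ℕ) : ∀ l : List A, l.length = k →
    FL (f + g) l = SS (fun s t => FL f s * FL g t) l := by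
  induction k with
  | zero =>
    intro l hl
    rw [List.length_eq_zero_iff] at hl
    subst hl
    simp [SS, FL_nil]
  | succ k ih =>
    intro l hl
    match l, hl with
    | a :: l, hl =>
      have hl' : l.length = k := by simpa using hl
      rw [FL_cons _ hfg, ih l hl', MS_congr a _ (SS (fun s t => FL f s * FL g t)) l
        (fun l' h => ih l' (h.trans hl')), MS_SS, SS, ← SS_add, sub_eq_iff_eq_add, ← SS_add,
        ← SS_mul]
      congr 1
      funext s t
      rw [FL_cons f hf, FL_cons g hg, MS_mul_left, MS_mul_right, LinearMap.add_apply]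
      ring

theorem FL_vanish {A B : Type*} [Ring A] [CommRing B] (n : ℕ) (f : A →ₗ[ℤ] B)
    (hf : IsNHom n f) (d : ℕ) : ∀ l : List A, l.length = n + 1 + d → FL f l = 0 := by
  induction d with
  | zero =>
    intro l hl
    rw [← hf.2 (fun i => l.get (Fin.cast hl.symm i))]
    exact (FL_eq f _ l hl.symm (fun _ => rfl)).symm
  | succ d ih =>
    intro l hl
    match l, hl with
    | a :: l, hl =>
      have hl' : l.length = n + 1 + d := by simp at hl; omega
      rw [FL_cons f hf.1, ih l hl', MS_zero a _ l (fun l' h => ih l' (h.trans hl'))]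
      simp

/-- The sum of an `n`-homomorphism and an `m`-homomorphism is an `(n+m)`-homomorphism. -/
theorem stmt5 {A B : Type*} [Ring A] [CommRing B] (n m : ℕ) (f g : A →ₗ[ℤ] B)
    (hf : IsNHom n f) (hg : IsNHom m g) :
    IsNHom (n + m) (f + g) := by
  have hfg : Central (f + g) := by
    intro a a'
    rw [LinearMap.add_apply, LinearMap.add_apply, hf.1, hg.1]
  refine ⟨hfg, fun a => ?_⟩
  rw [FL_eq (f + g) a (List.ofFn a) (by simp)
    (fun i => by rw [List.get_ofFn]; rfl),
    FL_add f g hf.1 hg.1 hfg _ _ rfl]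
  apply SS_zero
  intro s t hst
  rw [List.length_ofFn] at hst
  by_cases h : n + 1 ≤ s.length
  · rw [FL_vanish n f hf (s.length - (n + 1)) s (by omega), zero_mul]
  · rw [FL_vanish m g hg (t.length - (m + 1)) t (by omega), mul_zero]
end
end
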